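/- arXiv:2511.04103 — 2 statements merged into one kernel-verified Lean document; each statement's English description precedes it below -/
import Mathlib

section
/- Let C : ℕ → Set ℤ be any surjective enumeration of the family of languages {ℤ \ F : F ⊆ ℤ finite} (including ℤ itself, for F = ∅). Then for every k ≥ 1, C is not k-list identifiable in the limit. -/
/-- `x : ℕ → U` is an enumeration of the language `L ⊆ U`. -/
def IsEnumeration {U : Type*} (L : Set U) (x : ℕ → U) : Prop :=
  (∀ n, x n ∈ L) ∧ ∀ u ∈ L, ∃ n, x n = u

/-- The finite sequence consisting of the first `t` values of `x`. -/
def prefixList {U : Type*} (x : ℕ → U) (t : ℕ) : List U :=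
  List.ofFn (fun j : Fin t => x j)

/-- `A` is a `k`-list identifier that identifies the collection `C` in the limit. -/
def IdentifiesInLimit {U : Type*} (C : ℕ → Set U) (k : ℕ) (A : List U → Finset ℕ) : Prop :=
  (∀ s, (A s).card ≤ k) ∧
  ∀ z : ℕ, ∀ x : ℕ → U, IsEnumeration (C z) x →
    ∃ tStar : ℕ, ∀ t ≥ tStar, ∃ i ∈ A (prefixList x t), C i = C z

/-- The collection `C` is `k`-list identifiable in the limit. -/
def ListIdentifiable {U : Type*} (C : ℕ → Set U) (k : ℕ) : Prop :=
  ∃ A : List U → Finset ℕ, IdentifiesInLimit C k A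


/-- A chain of lists under the prefix order, of unbounded length, is the chain of prefixes of a
single infinite sequence. -/
theorem exists_prefixList_eq {U : Type*} (s : ℕ → List U)
    (hs : ∀ n, s n <+: s (n + 1)) (hlen : ∀ n, n ≤ (s n).length) :
    ∃ x : ℕ → U, ∀ n, prefixList x (s n).length = s n := by
  have hmono : ∀ m n, m ≤ n → s m <+: s n := fun m n hmn => by
    induction n, hmn using Nat.le_induction with
    | base => exact List.prefix_rfl
    | succ n _ ih => exact ih.trans (hs n)
  refine ⟨fun n => (s (n + 1))[n]'(hlen (n + 1)), fun n => ?_⟩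
  refine List.ext_getElem (by simp [prefixList]) fun j _ h₂ => ?_
  simp only [prefixList, List.getElem_ofFn]
  rcases le_total (j + 1) n with h | h
  · exact (hmono _ _ h).getElem _
  · exact ((hmono _ _ h).getElem h₂).symm

/-- If every enumeration of `L` eventually has only prefixes satisfying `P`, then every finite
sequence in `L` extends to one all of whose further extensions in `L` satisfy `P`. -/
theorem exists_locking_extension {U : Type*} {L : Set U} {e : ℕ → U} (he : IsEnumeration L e)
    {P : List U → Prop}
    (hP : ∀ x : ℕ → U, IsEnumeration L x → ∃ t₀ : ℕ, ∀ t ≥ t₀, P (prefixList x t))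
    {σ : List U} (hσ : ∀ u ∈ σ, u ∈ L) :
    ∃ τ, σ <+: τ ∧ (∀ u ∈ τ, u ∈ L) ∧ ∀ ρ, τ <+: ρ → (∀ u ∈ ρ, u ∈ L) → P ρ := by
  by_contra! hcon
  let T := {τ : List U // σ <+: τ ∧ ∀ u ∈ τ, u ∈ L}
  have hstep : ∀ (n : ℕ) (τ : T), ∃ ρ : T, τ.1 ++ [e n] <+: ρ.1 ∧ ¬ P ρ.1 := by
    rintro n ⟨τ, hστ, hτ⟩
    have hpre : σ <+: τ ++ [e n] := hστ.trans (List.prefix_append _ _)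
    obtain ⟨ρ, h₁, h₂, h₃⟩ := hcon (τ ++ [e n]) hpre (by
      intro u hu
      rcases List.mem_append.1 hu with hu | hu
      · exact hτ u hu
      · rw [List.mem_singleton.1 hu]
        exact he.1 n)
    exact ⟨⟨ρ, hpre.trans h₁, h₂⟩, h₁, h₃⟩
  choose f hf hfP using hstep
  let s : ℕ → T := fun n => Nat.rec ⟨σ, List.prefix_rfl, hσ⟩ f n
  have hs : ∀ n, (s n).1 ++ [e n] <+: (s (n + 1)).1 := fun n => hf n (s n)
  have hlen : ∀ n, n ≤ (s n).1.length := fun n => by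
    induction n with
    | zero => exact Nat.zero_le _
    | succ n ih =>
      have := (hs n).length_le
      simp only [List.length_append, List.length_singleton] at this
      omega
  obtain ⟨x, hx⟩ := exists_prefixList_eq (fun n => (s n).1)
    (fun n => (List.prefix_append _ _).trans (hs n)) hlen
  have hmem : ∀ n u, u ∈ (s n).1 ↔ ∃ j < (s n).1.length, x j = u := fun n u => by
    conv_lhs => rw [← hx n]
    simp [prefixList, List.mem_ofFn, Fin.exists_iff]
  obtain ⟨t₀, ht₀⟩ := hP x ⟨fun n => (s (n + 1)).2.2 _
      ((hmem (n + 1) (x n)).2 ⟨n, hlen (n + 1), rfl⟩), fun u hu => by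
    obtain ⟨n, rfl⟩ := he.2 u hu
    obtain ⟨j, _, hj⟩ := (hmem (n + 1) (e n)).1 ((hs n).subset (by simp))
    exact ⟨j, hj⟩⟩
  have := ht₀ (s (t₀ + 1)).1.length ((Nat.le_succ _).trans (hlen _))
  rw [hx (t₀ + 1)] at this
  exact hfP t₀ (s t₀) this

/-- If an identifier identifies every cofinite language, then for each `n` there are `n` cofinite
languages, all containing some cofinite language, that appear together on the list of every
extension, inside that language, of a suitable finite sequence. -/
theorem exists_jointly_locked_languages {C : ℕ → Set ℤ} {k : ℕ} {A : List ℤ → Finset ℕ}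
    (hsurj : ∀ F : Finset ℤ, ∃ i : ℕ, C i = (↑F : Set ℤ)ᶜ) (hA : IdentifiesInLimit C k A)
    (n : ℕ) :
    ∃ (σ : List ℤ) (F : Finset ℤ) (𝓛 : Finset (Set ℤ)), 𝓛.card = n ∧
      (∀ u ∈ σ, u ∈ (↑F : Set ℤ)ᶜ) ∧ (∀ L ∈ 𝓛, (↑F : Set ℤ)ᶜ ⊆ L) ∧
      ∀ L ∈ 𝓛, ∀ τ, σ <+: τ → (∀ u ∈ τ, u ∈ (↑F : Set ℤ)ᶜ) → ∃ i ∈ A τ, C i = L := by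
  classical
  induction n with
  | zero => exact ⟨[], ∅, ∅, by simp⟩
  | succ n ih =>
    obtain ⟨σ, F, 𝓛, hcard, hσ, hsub, hlock⟩ := ih
    obtain ⟨a, ha⟩ := Infinite.exists_notMem_finset (F ∪ σ.toFinset)
    simp only [Finset.mem_union, List.mem_toFinset, not_or] at ha
    have hlt : (↑(insert a F) : Set ℤ)ᶜ ⊆ (↑F : Set ℤ)ᶜ :=
      Set.compl_subset_compl.2 (by simp)
    obtain ⟨z, hz⟩ := hsurj (insert a F)
    obtain ⟨e, he⟩ := (Set.to_countable (↑(insert a F) : Set ℤ)ᶜ).exists_eq_range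
      (Set.Finite.infinite_compl (Finset.finite_toSet _)).nonempty
    have henum : IsEnumeration (↑(insert a F) : Set ℤ)ᶜ e := by
      rw [he]
      exact ⟨Set.mem_range_self, fun _ hu => hu⟩
    obtain ⟨τ, hστ, hτ, hτlock⟩ := exists_locking_extension henum
      (P := fun s => ∃ i ∈ A s, C i = (↑(insert a F) : Set ℤ)ᶜ)
      (fun x hx => by simpa only [hz] using hA.2 z x (hz ▸ hx)) (σ := σ) (fun u hu => by
        have h₁ : u ∉ F := hσ u hu
        have h₂ : u ≠ a := fun h => ha.2 (h ▸ hu)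
        simp [h₁, h₂])
    have hnew : (↑(insert a F) : Set ℤ)ᶜ ∉ 𝓛 := fun h => by
      simpa using hsub _ h (show a ∈ (↑F : Set ℤ)ᶜ from ha.1)
    refine ⟨τ, insert a F, insert (↑(insert a F) : Set ℤ)ᶜ 𝓛,
      by rw [Finset.card_insert_of_notMem hnew, hcard], hτ, fun L hL => ?_,
      fun L hL ρ hρ hρmem => ?_⟩
    · rcases Finset.mem_insert.1 hL with rfl | hL
      · exact subset_rfl
      · exact hlt.trans (hsub L hL)
    · rcases Finset.mem_insert.1 hL with rfl | hL
      · exact hτlock ρ hρ hρmem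
      · exact hlock L hL ρ (hστ.trans hρ) fun u hu => hlt (hρmem u hu)

/-- Any surjective enumeration `C` of the family
`{ℤ \ F : F ⊆ ℤ finite}` (including `ℤ` itself) is not `k`-list identifiable in the limit
for any `k ≥ 1`. -/
theorem cofinite_collection_not_list_identifiable
    (C : ℕ → Set ℤ)
    (hrange : ∀ i : ℕ, ∃ F : Finset ℤ, C i = (↑F : Set ℤ)ᶜ)
    (hsurj : ∀ F : Finset ℤ, ∃ i : ℕ, C i = (↑F : Set ℤ)ᶜ) :
    ∀ k : ℕ, 1 ≤ k → ¬ ListIdentifiable C k := by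
  classical
  rintro k - ⟨A, hA⟩
  obtain ⟨σ, F, 𝓛, hcard, hσ, -, hlock⟩ := exists_jointly_locked_languages hsurj hA (k + 1)
  have hle : 𝓛.card ≤ ((A σ).image C).card := Finset.card_le_card fun L hL =>
    Finset.mem_image.2 (hlock L hL σ List.prefix_rfl hσ)
  have := (hle.trans Finset.card_image_le).trans (hA.1 σ)
  omega
end

section
/- Let C : ℕ → Set ℤ be any surjective enumeration of the family consisting of the language ℤ together with the languages ℤ \ {i} for every i ∈ ℤ. Then C is not 1-list identifiable in the limit, but C is 2-list identifiable in the limit. -/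
open PiNat in
theorem isOpen_of_cylinder_subset {S : Set (ℕ → ℤ)}
    (h : ∀ x ∈ S, ∃ n, cylinder x n ⊆ S) : IsOpen S := by
  refine (isTopologicalBasis_cylinders (fun _ : ℕ => ℤ)).isOpen_iff.2 fun x hx => ?_
  obtain ⟨n, hn⟩ := h x hx
  exact ⟨cylinder x n, ⟨x, n, rfl⟩, self_mem_cylinder x n, hn⟩

open PiNat in
theorem dense_of_cylinder_inter_nonempty {S : Set (ℕ → ℤ)}
    (h : ∀ x n, (cylinder x n ∩ S).Nonempty) : Dense S := by
  refine (isTopologicalBasis_cylinders (fun _ : ℕ => ℤ)).dense_iff.2 ?_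
  rintro _ ⟨x, n, rfl⟩ -
  exact h x n

theorem prefixList_congr {U : Type*} {x y : ℕ → U} {t : ℕ} (h : ∀ i < t, y i = x i) :
    prefixList y t = prefixList x t :=
  congrArg List.ofFn (funext fun j => h j j.2)

theorem mem_prefixList {U : Type*} {x : ℕ → U} {t : ℕ} {u : U} :
    u ∈ prefixList x t ↔ ∃ i < t, x i = u := by
  simp [prefixList, List.mem_ofFn, Fin.exists_iff]

/-- Every finite sequence in a nonempty countable language extends to an
enumeration of that language. -/
theorem exists_isEnumeration_extending {U : Type*} {L : Set U} (hL : L.Countable)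
    (hne : L.Nonempty) (x : ℕ → U) (n : ℕ) (hx : ∀ i < n, x i ∈ L) :
    ∃ y, IsEnumeration L y ∧ ∀ i < n, y i = x i := by
  obtain ⟨f, rfl⟩ := hL.exists_eq_range hne
  refine ⟨fun i => if i < n then x i else f (i - n), ⟨fun i => ?_, ?_⟩, fun i hi => if_pos hi⟩
  · dsimp only
    split_ifs with hi
    exacts [hx i hi, ⟨_, rfl⟩]
  · rintro _ ⟨m, rfl⟩
    exact ⟨m + n, by simp⟩

theorem univ_ne_compl_singleton {U : Type*} (a : U) : (Set.univ : Set U) ≠ {a}ᶜ := fun h => by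
  have : a ∈ ({a}ᶜ : Set U) := h ▸ Set.mem_univ a
  exact this rfl

theorem not_listIdentifiable_one {C : ℕ → Set ℤ} (hZ : ∃ i, C i = Set.univ)
    (hpts : ∀ a : ℤ, ∃ i, C i = ({a} : Set ℤ)ᶜ) : ¬ ListIdentifiable C 1 := by
  rintro ⟨A, hcard, hA⟩
  have hopen_wrong (n : ℕ) :
      IsOpen {x : ℕ → ℤ | ∃ t ≥ n, ∀ i ∈ A (prefixList x t), C i ≠ Set.univ} := by
    refine isOpen_of_cylinder_subset ?_
    rintro x ⟨t, ht, h⟩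
    exact ⟨t, fun y hy => ⟨t, ht, by rwa [prefixList_congr hy]⟩⟩
  have hdense_wrong (n : ℕ) :
      Dense {x : ℕ → ℤ | ∃ t ≥ n, ∀ i ∈ A (prefixList x t), C i ≠ Set.univ} := by
    refine dense_of_cylinder_inter_nonempty fun x m => ?_
    obtain ⟨a, ha⟩ := Infinite.exists_notMem_finset ((Finset.range m).image x)
    obtain ⟨y, hy, hyx⟩ := exists_isEnumeration_extending (L := ({a} : Set ℤ)ᶜ)
      (Set.to_countable _) ⟨a + 1, by simp⟩ x m fun i hi h =>
        ha (Finset.mem_image.2 ⟨i, Finset.mem_range.2 hi, h⟩)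
    obtain ⟨z, hz⟩ := hpts a
    obtain ⟨T, hT⟩ := hA z y (hz ▸ hy)
    obtain ⟨i, hi, hiz⟩ := hT (max T n) (le_max_left _ _)
    refine ⟨y, hyx, max T n, le_max_right _ _, fun j hj hju => ?_⟩
    rw [Finset.card_le_one.1 (hcard _) j hj i hi, hiz, hz] at hju
    exact univ_ne_compl_singleton a hju.symm
  have hopen_hit (u : ℤ) : IsOpen {x : ℕ → ℤ | ∃ n, x n = u} := by
    refine isOpen_of_cylinder_subset ?_
    rintro x ⟨n, hn⟩
    exact ⟨n + 1, fun y hy => ⟨n, (hy n n.lt_succ_self).trans hn⟩⟩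
  have hdense_hit (u : ℤ) : Dense {x : ℕ → ℤ | ∃ n, x n = u} :=
    dense_of_cylinder_inter_nonempty fun x m =>
      ⟨fun i => if i < m then x i else u, fun i hi => if_pos hi, m, by simp⟩
  have hwrong := dense_iInter_of_isOpen hopen_wrong hdense_wrong
  have hhit := dense_iInter_of_isOpen hopen_hit hdense_hit
  have hGwrong := IsGδ.iInter_of_isOpen hopen_wrong
  have hGhit := IsGδ.iInter_of_isOpen hopen_hit
  obtain ⟨x, hx, hx'⟩ := (hwrong.inter_of_Gδ hGwrong hGhit hhit).nonempty
  rw [Set.mem_iInter] at hx hx'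
  obtain ⟨z, hz⟩ := hZ
  obtain ⟨T, hT⟩ := hA z x ⟨fun n => hz ▸ Set.mem_univ _, fun u _ => hx' u⟩
  obtain ⟨t, ht, h⟩ := hx T
  obtain ⟨i, hi, hiz⟩ := hT t ht
  exact h i hi (hiz.trans hz)

theorem exists_equiv_nat_notMem_list {U : Type*} [Infinite U] (e : ℕ ≃ U) (s : List U) :
    ∃ n, e n ∉ s := by
  classical
  obtain ⟨u, hu⟩ := Infinite.exists_notMem_finset s.toFinset
  exact ⟨e.symm u, by simpa using hu⟩

theorem listIdentifiable_two {C : ℕ → Set ℤ}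
    (hrange : ∀ i, C i = Set.univ ∨ ∃ a : ℤ, C i = ({a} : Set ℤ)ᶜ) (hZ : ∃ i, C i = Set.univ)
    (hpts : ∀ a : ℤ, ∃ i, C i = ({a} : Set ℤ)ᶜ) : ListIdentifiable C 2 := by
  classical
  obtain ⟨z₀, hz₀⟩ := hZ
  choose p hp using hpts
  let e : ℕ ≃ ℤ := (Denumerable.eqv ℤ).symm
  refine ⟨fun s => {z₀, p (e (Nat.find (exists_equiv_nat_notMem_list e s)))},
    fun s => Finset.card_le_two, fun z x hx => ?_⟩
  obtain hz | ⟨a, hz⟩ := hrange z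
  · exact ⟨0, fun t _ => ⟨z₀, by simp, hz₀.trans hz.symm⟩⟩
  rw [hz] at hx ⊢
  have hseen (m : ℕ) (hm : m < e.symm a) : ∃ n, x n = e m :=
    hx.2 _ fun h => hm.ne (e.injective (by simpa using h))
  choose! f hf using hseen
  refine ⟨(Finset.range (e.symm a)).sup f + 1, fun t ht =>
    ⟨_, Finset.mem_insert_of_mem (Finset.mem_singleton_self _), ?_⟩⟩
  have hfind : Nat.find (exists_equiv_nat_notMem_list e (prefixList x t)) = e.symm a := by
    refine (Nat.find_eq_iff _).2 ⟨?_, fun m hm => not_not.2 (mem_prefixList.2 ⟨f m, ?_, hf m hm⟩)⟩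
    · rw [e.apply_symm_apply, mem_prefixList]
      rintro ⟨i, -, hi⟩
      exact hx.1 i hi
    · exact (Nat.lt_succ_of_le (Finset.le_sup (Finset.mem_range.2 hm))).trans_le ht
  rw [hp, hfind, e.apply_symm_apply]

/-- Any surjective enumeration `C` of the family consisting of `ℤ`
together with the languages `ℤ \ {a}` for every `a ∈ ℤ` is not `1`-list identifiable in
the limit, but is `2`-list identifiable in the limit. -/
theorem Z_minus_point_collection
    (C : ℕ → Set ℤ)
    (hrange : ∀ i : ℕ, C i = (Set.univ : Set ℤ) ∨ ∃ a : ℤ, C i = ({a} : Set ℤ)ᶜ)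
    (hZ : ∃ i : ℕ, C i = (Set.univ : Set ℤ))
    (hpts : ∀ a : ℤ, ∃ i : ℕ, C i = ({a} : Set ℤ)ᶜ) :
    ¬ ListIdentifiable C 1 ∧ ListIdentifiable C 2 := by
  exact ⟨not_listIdentifiable_one hZ hpts, listIdentifiable_two hrange hZ hpts⟩
end
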